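/- The hexagonal lattice polytope Δ = conv{(2,0),(0,2),(−2,2),(−2,0),(0,−2),(2,−2)} ⊂ ℝ² satisfies: #(Δ ∩ ℤ²) = 19, Δ has exactly 7 interior lattice points, Δ has no column vectors (c(Δ) = 0), and Δ is maximal. Consequently #(Δ ∩ ℤ²) − c(Δ) − 3 = 16 = 2·7 + 2. -/

import Mathlib

noncomputable section

/-- The embedding of the integer lattice `ℤ²` into the plane `ℝ²`. -/
def toR2 (p : ℤ × ℤ) : ℝ × ℝ := ((p.1 : ℝ), (p.2 : ℝ))

/-- A lattice polytope in `ℝ²`: the convex hull of a finite set of lattice points. -/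
def IsLatticePolytope (Δ : Set (ℝ × ℝ)) : Prop :=
  ∃ S : Finset (ℤ × ℤ), Δ = convexHull ℝ (toR2 '' (S : Set (ℤ × ℤ)))

/-- The lattice points of `Δ`. -/
def latticePts (Δ : Set (ℝ × ℝ)) : Set (ℤ × ℤ) := {p | toR2 p ∈ Δ}

/-- The interior lattice points of `Δ`. -/
def intPts (Δ : Set (ℝ × ℝ)) : Set (ℤ × ℤ) := {p | toR2 p ∈ interior Δ}

/-- The boundary lattice points of `Δ`. -/
def bdPts (Δ : Set (ℝ × ℝ)) : Set (ℤ × ℤ) := {p | toR2 p ∈ frontier Δ}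

/-- `Δ⁽¹⁾`: the convex hull of the interior lattice points of `Δ`. -/
def interiorHull (Δ : Set (ℝ × ℝ)) : Set (ℝ × ℝ) := convexHull ℝ (toR2 '' intPts Δ)

/-- `Δ` is maximal: any lattice polytope strictly containing `Δ` has a different set of
interior lattice points. -/
def IsMaximalPolytope (Δ : Set (ℝ × ℝ)) : Prop :=
  ∀ Δ' : Set (ℝ × ℝ), IsLatticePolytope Δ' → Δ ⊂ Δ' → intPts Δ' ≠ intPts Δ

/-- `Δ` is hyperelliptic: its interior lattice points are collinear. -/
def IsHyperelliptic (Δ : Set (ℝ × ℝ)) : Prop := Collinear ℝ (toR2 '' intPts Δ)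

/-- A facet (edge) of `Δ`: a one-dimensional exposed face. -/
def IsFacet (Δ τ : Set (ℝ × ℝ)) : Prop :=
  IsExposed ℝ Δ τ ∧ Collinear ℝ τ ∧ ¬ τ.Subsingleton

/-- `v` is a column vector of `Δ`: `v ≠ 0` and there is a facet `τ` (the base facet)
such that `v + ((Δ ∖ τ) ∩ ℤ²) ⊆ Δ`. -/
def IsColumnVector (Δ : Set (ℝ × ℝ)) (v : ℤ × ℤ) : Prop :=
  v ≠ 0 ∧ ∃ τ : Set (ℝ × ℝ), IsFacet Δ τ ∧
    ∀ p : ℤ × ℤ, toR2 p ∈ Δ \ τ → toR2 (p + v) ∈ Δ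

/-- `c(Δ)`: the number of column vectors of `Δ`. -/
def colCount (Δ : Set (ℝ × ℝ)) : ℕ := {v : ℤ × ℤ | IsColumnVector Δ v}.ncard

/-- The hexagon `conv{(2,0),(0,2),(−2,2),(−2,0),(0,−2),(2,−2)}`. -/
def hexagon : Set (ℝ × ℝ) :=
  convexHull ℝ
    ({((2 : ℝ), (0 : ℝ)), (0, 2), (-2, 2), (-2, 0), (0, -2), (2, -2)} : Set (ℝ × ℝ))

lemma convex_coord_ineqs : Convex ℝ {z : ℝ × ℝ |
    -2 ≤ z.1 ∧ z.1 ≤ 2 ∧ -2 ≤ z.2 ∧ z.2 ≤ 2 ∧ -2 ≤ z.1 + z.2 ∧ z.1 + z.2 ≤ 2} := by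
  rintro ⟨x, y⟩ ⟨h1, h2, h3, h4, h5, h6⟩ ⟨x', y'⟩ ⟨k1, k2, k3, k4, k5, k6⟩ a b ha hb hab
  obtain rfl : b = 1 - a := by linarith
  simp only [Set.mem_ofPred_eq, Prod.fst_add, Prod.snd_add, Prod.smul_fst, Prod.smul_snd,
    smul_eq_mul] at *
  refine ⟨?_, ?_, ?_, ?_, ?_, ?_⟩ <;> nlinarith

/-- The triangle spanned by the origin and two points of the hexagon lies in the hexagon. -/
lemma triangle_subset_hexagon {A B : ℝ × ℝ} (hA : A ∈ hexagon) (hB : B ∈ hexagon)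
    {s t : ℝ} (hs : 0 ≤ s) (ht : 0 ≤ t) (hst : s + t ≤ 1) : s • A + t • B ∈ hexagon := by
  have hconv : Convex ℝ hexagon := convex_convexHull ℝ _
  have h0 : (0 : ℝ × ℝ) ∈ hexagon := by
    have h1 : ((2 : ℝ), (0 : ℝ)) ∈ hexagon := subset_convexHull ℝ _ (by simp)
    have h2 : ((-2 : ℝ), (0 : ℝ)) ∈ hexagon := subset_convexHull ℝ _ (by simp)
    have := hconv h1 h2 (a := 1 / 2) (b := 1 / 2) (by norm_num) (by norm_num) (by norm_num)
    convert this using 1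
    ext <;> simp
  have h := hconv.sum_mem (t := Finset.univ) (w := ![s, t, 1 - s - t]) (z := ![A, B, 0])
    (by intro i _; fin_cases i <;> simp <;> linarith)
    (by simp [Fin.sum_univ_three])
    (by intro i _; fin_cases i <;> simp [hA, hB, h0])
  simpa [Fin.sum_univ_three] using h

lemma mem_hexagon_iff (z : ℝ × ℝ) : z ∈ hexagon ↔
    -2 ≤ z.1 ∧ z.1 ≤ 2 ∧ -2 ≤ z.2 ∧ z.2 ≤ 2 ∧ -2 ≤ z.1 + z.2 ∧ z.1 + z.2 ≤ 2 := by
  constructor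
  · intro hz
    refine convexHull_min ?_ convex_coord_ineqs hz
    intro w hw
    simp only [Set.mem_insert_iff, Set.mem_singleton_iff] at hw
    rcases hw with rfl | rfl | rfl | rfl | rfl | rfl <;> norm_num
  · obtain ⟨x, y⟩ := z
    rintro ⟨h1, h2, h3, h4, h5, h6⟩
    simp only at h1 h2 h3 h4 h5 h6
    have v1 : ((2 : ℝ), (0 : ℝ)) ∈ hexagon := subset_convexHull ℝ _ (by simp)
    have v2 : ((0 : ℝ), (2 : ℝ)) ∈ hexagon := subset_convexHull ℝ _ (by simp)
    have v3 : ((-2 : ℝ), (2 : ℝ)) ∈ hexagon := subset_convexHull ℝ _ (by simp)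
    have v4 : ((-2 : ℝ), (0 : ℝ)) ∈ hexagon := subset_convexHull ℝ _ (by simp)
    have v5 : ((0 : ℝ), (-2 : ℝ)) ∈ hexagon := subset_convexHull ℝ _ (by simp)
    have v6 : ((2 : ℝ), (-2 : ℝ)) ∈ hexagon := subset_convexHull ℝ _ (by simp)
    have key : ∀ {A B : ℝ × ℝ} (s t : ℝ), A ∈ hexagon → B ∈ hexagon → 0 ≤ s → 0 ≤ t →
        s + t ≤ 1 → x = s * A.1 + t * B.1 → y = s * A.2 + t * B.2 → (x, y) ∈ hexagon := by
      intro A B s t hA hB hs ht hst hx hy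
      convert triangle_subset_hexagon hA hB hs ht hst using 1
      ext <;> simp [hx, hy]
    rcases le_total 0 x with hx | hx <;> rcases le_total 0 y with hy | hy
    · exact key (x / 2) (y / 2) v1 v2 (by linarith) (by linarith) (by linarith)
        (by simp) (by simp)
    · rcases le_total 0 (x + y) with hxy | hxy
      · exact key ((x + y) / 2) (-y / 2) v1 v6 (by linarith) (by linarith) (by linarith)
          (by ring) (by ring)
      · exact key (-(x + y) / 2) (x / 2) v5 v6 (by linarith) (by linarith) (by linarith)
          (by ring) (by ring)
    · rcases le_total 0 (x + y) with hxy | hxy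
      · exact key ((x + y) / 2) (-x / 2) v2 v3 (by linarith) (by linarith) (by linarith)
          (by ring) (by ring)
      · exact key (-(x + y) / 2) (y / 2) v4 v3 (by linarith) (by linarith) (by linarith)
          (by ring) (by ring)
    · exact key (-x / 2) (-y / 2) v4 v5 (by linarith) (by linarith) (by linarith)
        (by ring) (by ring)

lemma mem_interior_hexagon_iff (z : ℝ × ℝ) : z ∈ interior hexagon ↔
    -2 < z.1 ∧ z.1 < 2 ∧ -2 < z.2 ∧ z.2 < 2 ∧ -2 < z.1 + z.2 ∧ z.1 + z.2 < 2 := by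
  constructor
  · intro hz
    obtain ⟨ε, hε, hball⟩ := Metric.mem_nhds_iff.1 (mem_interior_iff_mem_nhds.1 hz)
    have hmem : ∀ δ : ℝ, |δ| < ε → (z.1 + δ, z.2 + δ) ∈ hexagon := by
      intro δ hδ
      apply hball
      simp [Prod.dist_eq, hδ]
    have hp := (mem_hexagon_iff _).1 (hmem (ε / 2) (by rw [abs_of_pos] <;> linarith))
    have hm := (mem_hexagon_iff _).1 (hmem (-(ε / 2)) (by rw [abs_neg, abs_of_pos] <;> linarith))
    simp only at hp hm
    refine ⟨?_, ?_, ?_, ?_, ?_, ?_⟩ <;> linarith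
  · intro hz
    let U : Set (ℝ × ℝ) := {z | -2 < z.1 ∧ z.1 < 2 ∧ -2 < z.2 ∧ z.2 < 2 ∧
      -2 < z.1 + z.2 ∧ z.1 + z.2 < 2}
    have hU : IsOpen U := by
      refine IsOpen.and ?_ (IsOpen.and ?_ (IsOpen.and ?_ (IsOpen.and ?_ (IsOpen.and ?_ ?_)))) <;>
        exact isOpen_lt (by fun_prop) (by fun_prop)
    refine interior_maximal ?_ hU hz
    rintro w ⟨h1, h2, h3, h4, h5, h6⟩
    exact (mem_hexagon_iff w).2 ⟨h1.le, h2.le, h3.le, h4.le, h5.le, h6.le⟩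

lemma toR2_mem_hexagon_iff (p : ℤ × ℤ) : toR2 p ∈ hexagon ↔
    -2 ≤ p.1 ∧ p.1 ≤ 2 ∧ -2 ≤ p.2 ∧ p.2 ≤ 2 ∧ -2 ≤ p.1 + p.2 ∧ p.1 + p.2 ≤ 2 := by
  rw [mem_hexagon_iff]
  simp only [toR2]
  norm_cast

lemma toR2_mem_interior_hexagon_iff (p : ℤ × ℤ) : toR2 p ∈ interior hexagon ↔
    -2 < p.1 ∧ p.1 < 2 ∧ -2 < p.2 ∧ p.2 < 2 ∧ -2 < p.1 + p.2 ∧ p.1 + p.2 < 2 := by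
  rw [mem_interior_hexagon_iff]
  simp only [toR2]
  norm_cast

lemma ncard_latticePts_hexagon : (latticePts hexagon).ncard = 19 := by
  have h : latticePts hexagon = ((Finset.Icc (-2 : ℤ) 2 ×ˢ Finset.Icc (-2 : ℤ) 2).filter
      (fun p => -2 ≤ p.1 + p.2 ∧ p.1 + p.2 ≤ 2) : Finset (ℤ × ℤ)) := by
    ext p
    simp only [latticePts, Set.mem_ofPred_eq, toR2_mem_hexagon_iff, Finset.coe_filter,
      Finset.mem_product, Finset.mem_Icc]
    tauto
  rw [h, Set.ncard_coe_finset]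
  decide

lemma ncard_intPts_hexagon : (intPts hexagon).ncard = 7 := by
  have h : intPts hexagon = ((Finset.Ioo (-2 : ℤ) 2 ×ˢ Finset.Ioo (-2 : ℤ) 2).filter
      (fun p => -2 < p.1 + p.2 ∧ p.1 + p.2 < 2) : Finset (ℤ × ℤ)) := by
    ext p
    simp only [intPts, Set.mem_ofPred_eq, toR2_mem_interior_hexagon_iff, Finset.coe_filter,
      Finset.mem_product, Finset.mem_Ioo]
    tauto
  rw [h, Set.ncard_coe_finset]
  decide

/-- A collinear subset of the plane lies on a line `α x + β y = γ`. -/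
lemma Collinear.exists_line_equation {τ : Set (ℝ × ℝ)} (h : Collinear ℝ τ) :
    ∃ α β γ : ℝ, ¬ (α = 0 ∧ β = 0) ∧ ∀ p ∈ τ, α * p.1 + β * p.2 = γ := by
  obtain ⟨p₀, v, hv⟩ := (collinear_iff_exists_forall_eq_smul_vadd τ).1 h
  by_cases hv0 : v = 0
  · refine ⟨1, 0, p₀.1, by simp, fun p hp => ?_⟩
    obtain ⟨r, rfl⟩ := hv p hp
    simp [hv0]
  · refine ⟨v.2, -v.1, v.2 * p₀.1 - v.1 * p₀.2, ?_, fun p hp => ?_⟩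
    · rintro ⟨h2, h1⟩
      exact hv0 (Prod.ext (neg_eq_zero.1 h1) h2)
    · obtain ⟨r, rfl⟩ := hv p hp
      simp only [vadd_eq_add, Prod.fst_add, Prod.snd_add, Prod.smul_fst, Prod.smul_snd,
        smul_eq_mul]
      ring

lemma not_isColumnVector_hexagon (v : ℤ × ℤ) : ¬ IsColumnVector hexagon v := by
  rintro ⟨hv, τ, ⟨-, hcol, -⟩, hτ⟩
  obtain ⟨a, b⟩ := v
  have hab : ¬ (a = 0 ∧ b = 0) := fun h => hv (by simp [h.1, h.2])
  obtain ⟨α, β, γ, hne, hline⟩ := hcol.exists_line_equation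
  have key : ∀ p : ℤ × ℤ, toR2 p ∈ hexagon → α * p.1 + β * p.2 = γ ∨
      (-2 ≤ p.1 + a ∧ p.1 + a ≤ 2 ∧ -2 ≤ p.2 + b ∧ p.2 + b ≤ 2 ∧
        -2 ≤ (p.1 + a) + (p.2 + b) ∧ (p.1 + a) + (p.2 + b) ≤ 2) := by
    intro p hp
    by_cases hpτ : toR2 p ∈ τ
    · exact Or.inl (hline _ hpτ)
    · exact Or.inr ((toR2_mem_hexagon_iff _).1 (hτ p ⟨hp, hpτ⟩))
  have k1 := key (2, 0) (by rw [toR2_mem_hexagon_iff]; norm_num)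
  have k2 := key (0, 2) (by rw [toR2_mem_hexagon_iff]; norm_num)
  have k3 := key (-2, 2) (by rw [toR2_mem_hexagon_iff]; norm_num)
  have k4 := key (-2, 0) (by rw [toR2_mem_hexagon_iff]; norm_num)
  have k5 := key (0, -2) (by rw [toR2_mem_hexagon_iff]; norm_num)
  have k6 := key (2, -2) (by rw [toR2_mem_hexagon_iff]; norm_num)
  push_cast at k1 k2 k3 k4 k5 k6
  rcases k1 with k1 | k1 <;> rcases k2 with k2 | k2 <;> rcases k3 with k3 | k3 <;>
    rcases k4 with k4 | k4 <;> rcases k5 with k5 | k5 <;> rcases k6 with k6 | k6 <;>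
    first
      | exact hne ⟨by linarith, by linarith⟩
      | exact hab ⟨by omega, by omega⟩

lemma colCount_hexagon : colCount hexagon = 0 := by
  simp [colCount, not_isColumnVector_hexagon]

/-- If the segment from `p ∈ C` through `m` can be prolonged beyond `m` into the interior of
the convex set `C`, then `m` is an interior point of `C`. -/
lemma Convex.mem_interior_of_prolong {C : Set (ℝ × ℝ)} (hC : Convex ℝ C) {p m : ℝ × ℝ}
    (hp : p ∈ C) {ε : ℝ} (hε : 0 < ε)
    (hq : (m.1 - ε * (p.1 - m.1), m.2 - ε * (p.2 - m.2)) ∈ interior C) : m ∈ interior C := by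
  refine hC.openSegment_interior_self_subset_interior hq hp
    ⟨1 / (1 + ε), ε / (1 + ε), by positivity, by positivity, by field_simp, ?_⟩
  ext <;> simp <;> field_simp <;> ring

lemma exists_small_scale (u v : ℝ) : ∃ ε > 0, |ε * u| < 1 / 2 ∧ |ε * v| < 1 / 2 := by
  have hpos : 0 < 1 + |u| + |v| := by positivity
  refine ⟨1 / (2 * (1 + |u| + |v|)), by positivity, ?_, ?_⟩ <;>
  · rw [abs_mul, abs_of_pos (by positivity), div_mul_eq_mul_div, div_lt_div_iff₀] <;>
      linarith [abs_nonneg u, abs_nonneg v]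

lemma isMaximalPolytope_hexagon : IsMaximalPolytope hexagon := by
  rintro C ⟨S, rfl⟩ hss heq
  have hC := convex_convexHull ℝ (toR2 '' (S : Set (ℤ × ℤ)))
  generalize convexHull ℝ (toR2 '' (S : Set (ℤ × ℤ))) = C at *
  obtain ⟨⟨x, y⟩, hpC, hp⟩ := Set.exists_of_ssubset hss
  have bound : ∀ m : ℤ × ℤ, toR2 m ∉ interior hexagon →
      ∃ ε > 0, ∃ s t : ℝ, s = ε * (x - m.1) ∧ t = ε * (y - m.2) ∧
        s + t = ε * (x + y - (m.1 + m.2)) ∧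
        -(1 / 2) < s ∧ s < 1 / 2 ∧ -(1 / 2) < t ∧ t < 1 / 2 ∧
        ¬ (-2 < m.1 - s ∧ m.1 - s < 2 ∧ -2 < m.2 - t ∧ m.2 - t < 2 ∧
          -2 < (m.1 - s) + (m.2 - t) ∧ (m.1 - s) + (m.2 - t) < 2) := by
    intro m hm
    obtain ⟨ε, hε, h1, h2⟩ := exists_small_scale (x - m.1) (y - m.2)
    refine ⟨ε, hε, _, _, rfl, rfl, by ring, (abs_lt.1 h1).1, (abs_lt.1 h1).2, (abs_lt.1 h2).1,
      (abs_lt.1 h2).2, fun hq => hm ?_⟩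
    have hmC : m ∈ intPts C := hC.mem_interior_of_prolong hpC hε
      (interior_mono hss.1 ((mem_interior_hexagon_iff _).2 hq))
    rwa [heq] at hmC
  apply hp
  rw [mem_hexagon_iff]
  refine ⟨?_, ?_, ?_, ?_, ?_, ?_⟩ <;> by_contra! hlt <;> simp only at hlt
  · obtain ⟨ε, hε, s, t, hs, ht, hst, h1, h2, h3, h4, h5⟩ :=
      bound (-2, 1) (by rw [toR2_mem_interior_hexagon_iff]; norm_num)
    push_cast at hs ht hst h5
    have : s < 0 := by rw [hs]; exact mul_neg_of_pos_of_neg hε (by linarith)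
    exact h5 ⟨by linarith, by linarith, by linarith, by linarith, by linarith, by linarith⟩
  · obtain ⟨ε, hε, s, t, hs, ht, hst, h1, h2, h3, h4, h5⟩ :=
      bound (2, -1) (by rw [toR2_mem_interior_hexagon_iff]; norm_num)
    push_cast at hs ht hst h5
    have : 0 < s := by rw [hs]; exact mul_pos hε (by linarith)
    exact h5 ⟨by linarith, by linarith, by linarith, by linarith, by linarith, by linarith⟩
  · obtain ⟨ε, hε, s, t, hs, ht, hst, h1, h2, h3, h4, h5⟩ :=
      bound (1, -2) (by rw [toR2_mem_interior_hexagon_iff]; norm_num)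
    push_cast at hs ht hst h5
    have : t < 0 := by rw [ht]; exact mul_neg_of_pos_of_neg hε (by linarith)
    exact h5 ⟨by linarith, by linarith, by linarith, by linarith, by linarith, by linarith⟩
  · obtain ⟨ε, hε, s, t, hs, ht, hst, h1, h2, h3, h4, h5⟩ :=
      bound (-1, 2) (by rw [toR2_mem_interior_hexagon_iff]; norm_num)
    push_cast at hs ht hst h5
    have : 0 < t := by rw [ht]; exact mul_pos hε (by linarith)
    exact h5 ⟨by linarith, by linarith, by linarith, by linarith, by linarith, by linarith⟩
  · obtain ⟨ε, hε, s, t, hs, ht, hst, h1, h2, h3, h4, h5⟩ :=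
      bound (-1, -1) (by rw [toR2_mem_interior_hexagon_iff]; norm_num)
    push_cast at hs ht hst h5
    have : s + t < 0 := by rw [hst]; exact mul_neg_of_pos_of_neg hε (by linarith)
    exact h5 ⟨by linarith, by linarith, by linarith, by linarith, by linarith, by linarith⟩
  · obtain ⟨ε, hε, s, t, hs, ht, hst, h1, h2, h3, h4, h5⟩ :=
      bound (1, 1) (by rw [toR2_mem_interior_hexagon_iff]; norm_num)
    push_cast at hs ht hst h5
    have : 0 < s + t := by rw [hst]; exact mul_pos hε (by linarith)
    exact h5 ⟨by linarith, by linarith, by linarith, by linarith, by linarith, by linarith⟩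

/-- the hexagon has 19 lattice points, 7 interior lattice points, no
column vectors, and is maximal; consequently `#(Δ ∩ ℤ²) − c(Δ) − 3 = 16 = 2·7 + 2`. -/
theorem hexagon_counts :
    (latticePts hexagon).ncard = 19 ∧
    (intPts hexagon).ncard = 7 ∧
    colCount hexagon = 0 ∧
    IsMaximalPolytope hexagon ∧
    ((latticePts hexagon).ncard : ℤ) - (colCount hexagon : ℤ) - 3 = 16 ∧
    (16 : ℤ) = 2 * 7 + 2 := by
  refine ⟨ncard_latticePts_hexagon, ncard_intPts_hexagon, colCount_hexagon,
    isMaximalPolytope_hexagon, ?_, by norm_num⟩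
  rw [ncard_latticePts_hexagon, colCount_hexagon]
  norm_num
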